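/- For t with 1 ≤ t ≤ 4: if Δ ⊆ ℕ×ℕ is a down-set (for the componentwise order) with |Δ| ≤ t, S ⊆ ℕ×ℕ is the set of minimal elements of the complement of Δ, and l = (l₁,l₂) satisfies l₁ ≥ 1, l₂ ≥ 1 and (l₁+1)(l₂+1) > 2t+1, then l ∉ S + Δ := {s+d : s ∈ S, d ∈ Δ}. -/

import Mathlib

/-- A set Δ ⊆ ℕ × ℕ is a down-set for the componentwise order. -/
def IsDownset (Δ : Set (ℕ × ℕ)) : Prop :=
  ∀ m ∈ Δ, ∀ n : ℕ × ℕ, n.1 ≤ m.1 → n.2 ≤ m.2 → n ∈ Δ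

/-- The points of a 5 × 5 box below `(c, e)` or strictly below `(a, b)`. -/
def boxPts (a b c e : ℕ) : Finset (ℕ × ℕ) :=
  (Finset.range 5 ×ˢ Finset.range 5).filter
    (fun p => (p.1 ≤ c ∧ p.2 ≤ e) ∨ (p.1 ≤ a ∧ p.2 ≤ b ∧ ¬ (p.1 = a ∧ p.2 = b)))

set_option synthInstance.maxHeartbeats 400000 in
set_option synthInstance.maxSize 2000 in
set_option maxHeartbeats 1000000 in
lemma boxPts_check : ∀ t < 5, ∀ a < 5, ∀ b < 5, ∀ c < 5, ∀ e < 5,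
    ¬ (a ≤ c ∧ b ≤ e) → 1 ≤ a + c → 1 ≤ b + e → (boxPts a b c e).card ≤ t →
    (a + c + 1) * (b + e + 1) ≤ 2 * t + 1 := by
  decide +kernel

/-- Lemma "puntos fuera de la escalera": for 1 ≤ t ≤ 4, if Δ is a finite down-set with
|Δ| ≤ t, S the set of minimal elements of its complement, and l has both coordinates ≥ 1
with (l₁+1)(l₂+1) > 2t+1, then l ∉ S + Δ. -/
theorem stmt11 (t : ℕ) (h1 : 1 ≤ t) (h2 : t ≤ 4)
    (Δ : Set (ℕ × ℕ)) (hΔ : IsDownset Δ) (hfin : Δ.Finite) (hcard : Δ.ncard ≤ t)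
    (l : ℕ × ℕ) (hl1 : 1 ≤ l.1) (hl2 : 1 ≤ l.2)
    (hl : 2 * t + 1 < (l.1 + 1) * (l.2 + 1)) :
    l ∉ {p : ℕ × ℕ |
      ∃ s ∈ {s : ℕ × ℕ | s ∉ Δ ∧
        ∀ s' : ℕ × ℕ, s' ∉ Δ → s'.1 ≤ s.1 → s'.2 ≤ s.2 → s' = s},
      ∃ d ∈ Δ, p = s + d} := by
  rintro ⟨⟨a, b⟩, ⟨hs, hmin⟩, ⟨c, e⟩, hd, rfl⟩
  have hlow : ∀ x y, x ≤ a → y ≤ b → ¬ (x = a ∧ y = b) → (x, y) ∈ Δ := by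
    intro x y hx hy hne
    by_contra hn
    have := hmin (x, y) hn hx hy
    simp only [Prod.mk.injEq] at this
    exact hne this
  have hcardF : ∀ F : Finset (ℕ × ℕ), (∀ p ∈ F, p ∈ Δ) → F.card ≤ t := by
    intro F hF
    rw [← Set.ncard_coe_finset]
    exact (Set.ncard_le_ncard (fun p hp => hF p hp) hfin).trans hcard
  have hrow : ∀ n, (∀ x < n, (x, 0) ∈ Δ) → n ≤ t := by
    intro n hn
    have := hcardF ((Finset.range n).image (fun x => (x, 0))) (by
      intro p hp
      obtain ⟨x, hx, rfl⟩ := Finset.mem_image.1 hp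
      exact hn x (Finset.mem_range.1 hx))
    rwa [Finset.card_image_of_injective _ (fun x y h => (Prod.mk.inj h).1),
      Finset.card_range] at this
  have hcol : ∀ n, (∀ x < n, (0, x) ∈ Δ) → n ≤ t := by
    intro n hn
    have := hcardF ((Finset.range n).image (fun x => (0, x))) (by
      intro p hp
      obtain ⟨x, hx, rfl⟩ := Finset.mem_image.1 hp
      exact hn x (Finset.mem_range.1 hx))
    rwa [Finset.card_image_of_injective _ (fun x y h => (Prod.mk.inj h).2),
      Finset.card_range] at this
  have ha := hrow a (fun x hx => hlow x 0 (by omega) (by omega) (by omega))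
  have hb := hcol b (fun x hx => hlow 0 x (by omega) (by omega) (by omega))
  have hc := hrow (c + 1) (fun x hx => hΔ _ hd (x, 0) (by simp; omega) (by simp))
  have he := hcol (e + 1) (fun x hx => hΔ _ hd (0, x) (by simp) (by simp; omega))
  have hF := hcardF (boxPts a b c e) (by
    rintro ⟨x, y⟩ hp
    rcases (Finset.mem_filter.1 hp).2 with h | h
    · exact hΔ _ hd _ h.1 h.2
    · exact hlow x y h.1 h.2.1 h.2.2)
  have := boxPts_check t (by omega) a (by omega) b (by omega) c (by omega) e (by omega)
    (fun h => hs (hΔ _ hd _ h.1 h.2)) hl1 hl2 hF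
  simp only [Prod.mk_add_mk] at hl
  omega
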